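/- arXiv:1701.05298 — 2 statements merged into one kernel-verified Lean document; each statement's English description precedes it below -/
import Mathlib

section
/- Let (x, y, μ, λ) ∈ ℝⁿ × E × ℝᵐ × E be a KKT quadruple of problem (P2), where E has rank r, and suppose the SOSC-NLP holds at (x, y, μ, λ): ⟨∇²_x L(x,μ,λ)v, v⟩ + 2⟨w∘w, λ⟩ > 0 for every nonzero (v, w) ∈ ℝⁿ × E with Dg(x)v − 2 y∘w = 0 and Dh(x)v = 0. Then (x, μ, λ) is a KKT triple of problem (P1) satisfying strict complementarity, i.e., rank g(x) + rank λ = r. -/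
open scoped RealInnerProductSpace

noncomputable section

/-- A Euclidean Jordan algebra structure on a finite-dimensional real inner
product space `E`: a commutative bilinear product `jmul` with unit, satisfying
the Jordan identity and compatibility with the inner product, together with the
spectral theorem (every element has a spectral decomposition along a Jordan
frame of size `rank`) and the normalization `⟪c, c⟫ = 1` for primitive
idempotents, which encodes that the inner product is the trace form. -/
structure EJA (E : Type*) [NormedAddCommGroup E] [InnerProductSpace ℝ E]
    [FiniteDimensional ℝ E] where
  jmul : E →ₗ[ℝ] E →ₗ[ℝ] E
  comm : ∀ y z : E, jmul y z = jmul z y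
  unit : E
  unit_jmul : ∀ y : E, jmul unit y = y
  jordan : ∀ y z : E, jmul y (jmul (jmul y y) z) = jmul (jmul y y) (jmul y z)
  assoc_inner : ∀ y z w : E, ⟪jmul y z, w⟫ = ⟪y, jmul z w⟫
  rank : ℕ
  spectral : ∀ y : E, ∃ (c : Fin rank → E) (σ : Fin rank → ℝ),
    (∀ i, jmul (c i) (c i) = c i) ∧
    (∀ i, c i ≠ 0) ∧
    (∀ i, ∀ a b : E, jmul a a = a → jmul b b = b → a ≠ 0 → b ≠ 0 →
      jmul a b = 0 → c i ≠ a + b) ∧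
    (∀ i j, i ≠ j → jmul (c i) (c j) = 0) ∧
    (∑ i, c i) = unit ∧
    y = ∑ i, σ i • c i
  inner_primitive : ∀ c : E, jmul c c = c → c ≠ 0 →
    (∀ a b : E, jmul a a = a → jmul b b = b → a ≠ 0 → b ≠ 0 →
      jmul a b = 0 → c ≠ a + b) →
    ⟪c, c⟫ = 1

namespace EJA

variable {E : Type*} [NormedAddCommGroup E] [InnerProductSpace ℝ E]
  [FiniteDimensional ℝ E]

/-- `c` is an idempotent. -/
def IsIdempotent (J : EJA E) (c : E) : Prop := J.jmul c c = c

/-- `c` is a primitive idempotent. -/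
def IsPrimitive (J : EJA E) (c : E) : Prop :=
  J.IsIdempotent c ∧ c ≠ 0 ∧
    ∀ a b : E, J.IsIdempotent a → J.IsIdempotent b → a ≠ 0 → b ≠ 0 →
      J.jmul a b = 0 → c ≠ a + b

/-- A Jordan frame: primitive idempotents, pairwise orthogonal (w.r.t. the
Jordan product), summing to the unit. -/
def IsJordanFrame (J : EJA E) (c : Fin J.rank → E) : Prop :=
  (∀ i, J.IsPrimitive (c i)) ∧ (∀ i j, i ≠ j → J.jmul (c i) (c j) = 0) ∧
    (∑ i, c i) = J.unit

/-- The symmetric cone: the cone of squares of the algebra. -/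
def K (J : EJA E) : Set E := {z : E | ∃ y : E, z = J.jmul y y}

/-- `y` has rank `k`: some spectral decomposition of `y` has exactly `k`
nonzero eigenvalues.  (By uniqueness of eigenvalues this is well-defined.) -/
def HasRank (J : EJA E) (y : E) (k : ℕ) : Prop :=
  ∃ (c : Fin J.rank → E) (σ : Fin J.rank → ℝ),
    J.IsJordanFrame c ∧ y = ∑ i, σ i • c i ∧
      (Finset.univ.filter (fun i => σ i ≠ 0)).card = k

/-- `t` is an eigenvalue of `y`. -/
def IsEigenvalue (J : EJA E) (y : E) (t : ℝ) : Prop :=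
  ∃ (c : Fin J.rank → E) (σ : Fin J.rank → ℝ) (i : Fin J.rank),
    J.IsJordanFrame c ∧ y = ∑ j, σ j • c j ∧ σ i = t

/-- `p` is a nearest point of the symmetric cone `K` to `v`. -/
def IsProj (J : EJA E) (v p : E) : Prop :=
  p ∈ J.K ∧ ∀ z ∈ J.K, ‖v - p‖ ≤ ‖v - z‖

/-- A (linear subspace that is a) subalgebra. -/
def IsSubalgebra (J : EJA E) (V : Submodule ℝ E) : Prop :=
  ∀ a ∈ V, ∀ b ∈ V, J.jmul a b ∈ V

/-- The algebra is simple: it is not the direct sum of two nonzero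
subalgebras. -/
def IsSimple (J : EJA E) : Prop :=
  ¬ ∃ V W : Submodule ℝ E, J.IsSubalgebra V ∧ J.IsSubalgebra W ∧
      V ≠ ⊥ ∧ W ≠ ⊥ ∧ V ⊓ W = ⊥ ∧ V ⊔ W = ⊤

/-- The tangent cone of the convex set `K` at `z`:
the closure of `⋃_{t>0} t (K - z)`. -/
def tangentCone (J : EJA E) (z : E) : Set E :=
  closure {d : E | ∃ t : ℝ, 0 < t ∧ ∃ k ∈ J.K, d = t • (k - z)}

/-- The lineality space `T_K(z) ∩ (-T_K(z))` of the tangent cone. -/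
def linTangent (J : EJA E) (z : E) : Set E :=
  {d : E | d ∈ J.tangentCone z ∧ -d ∈ J.tangentCone z}

/-- The Lagrangian of problem (P1):
`L(x, μ, λ) = f(x) - ⟪h(x), μ⟫ - ⟪g(x), λ⟫`. -/
def lagr {n m : ℕ} (f : EuclideanSpace ℝ (Fin n) → ℝ)
    (h : EuclideanSpace ℝ (Fin n) → EuclideanSpace ℝ (Fin m))
    (g : EuclideanSpace ℝ (Fin n) → E) (μ : EuclideanSpace ℝ (Fin m)) (lam : E)
    (x : EuclideanSpace ℝ (Fin n)) : ℝ :=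
  f x - ⟪h x, μ⟫ - ⟪g x, lam⟫

/-- The Lagrangian of the slack-variable problem (P2), as a function of the
pair `(x, y)`. -/
def lagrSlack (J : EJA E) {n m : ℕ} (f : EuclideanSpace ℝ (Fin n) → ℝ)
    (h : EuclideanSpace ℝ (Fin n) → EuclideanSpace ℝ (Fin m))
    (g : EuclideanSpace ℝ (Fin n) → E) (μ : EuclideanSpace ℝ (Fin m)) (lam : E)
    (p : EuclideanSpace ℝ (Fin n) × E) : ℝ :=
  f p.1 - ⟪h p.1, μ⟫ - ⟪g p.1 - J.jmul p.2 p.2, lam⟫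

/-- `(x, μ, lam)` is a KKT triple of problem (P1). -/
def KKTP1 (J : EJA E) {n m : ℕ} (f : EuclideanSpace ℝ (Fin n) → ℝ)
    (h : EuclideanSpace ℝ (Fin n) → EuclideanSpace ℝ (Fin m))
    (g : EuclideanSpace ℝ (Fin n) → E)
    (x : EuclideanSpace ℝ (Fin n)) (μ : EuclideanSpace ℝ (Fin m)) (lam : E) : Prop :=
  gradient f x - (fderiv ℝ h x).adjoint μ - (fderiv ℝ g x).adjoint lam = 0 ∧
    lam ∈ J.K ∧ g x ∈ J.K ∧ J.jmul lam (g x) = 0 ∧ h x = 0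

/-- `(x, y, μ, lam)` is a KKT quadruple of the slack-variable problem (P2). -/
def KKTP2 (J : EJA E) {n m : ℕ} (f : EuclideanSpace ℝ (Fin n) → ℝ)
    (h : EuclideanSpace ℝ (Fin n) → EuclideanSpace ℝ (Fin m))
    (g : EuclideanSpace ℝ (Fin n) → E)
    (x : EuclideanSpace ℝ (Fin n)) (y : E) (μ : EuclideanSpace ℝ (Fin m))
    (lam : E) : Prop :=
  gradient f x - (fderiv ℝ h x).adjoint μ - (fderiv ℝ g x).adjoint lam = 0 ∧
    J.jmul lam y = 0 ∧ g x = J.jmul y y ∧ h x = 0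

/-- The augmented Lagrangian of the slack-variable problem (P2). -/
def augSlack (J : EJA E) {n m : ℕ} (f : EuclideanSpace ℝ (Fin n) → ℝ)
    (h : EuclideanSpace ℝ (Fin n) → EuclideanSpace ℝ (Fin m))
    (g : EuclideanSpace ℝ (Fin n) → E) (ρ : ℝ) (μ : EuclideanSpace ℝ (Fin m))
    (lam : E) (x : EuclideanSpace ℝ (Fin n)) (y : E) : ℝ :=
  f x - ⟪h x, μ⟫ + ρ / 2 * ‖h x‖ ^ 2 - ⟪g x - J.jmul y y, lam⟫
    + ρ / 2 * ‖g x - J.jmul y y‖ ^ 2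

/-- The augmented Lagrangian of problem (P1), where `P` is the metric
projection onto the symmetric cone `K`. -/
def augSym (J : EJA E) {n m : ℕ} (f : EuclideanSpace ℝ (Fin n) → ℝ)
    (h : EuclideanSpace ℝ (Fin n) → EuclideanSpace ℝ (Fin m))
    (g : EuclideanSpace ℝ (Fin n) → E) (P : E → E) (ρ : ℝ)
    (μ : EuclideanSpace ℝ (Fin m)) (lam : E)
    (x : EuclideanSpace ℝ (Fin n)) : ℝ :=
  f x - ⟪h x, μ⟫ + ρ / 2 * ‖h x‖ ^ 2
    + 1 / (2 * ρ) * (-‖lam‖ ^ 2 + ‖P (lam - ρ • g x)‖ ^ 2)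

end EJA

namespace EJA

variable {E : Type*} [NormedAddCommGroup E] [InnerProductSpace ℝ E]
  [FiniteDimensional ℝ E]

theorem jmul_unit (J : EJA E) (a : E) : J.jmul a J.unit = a := by
  rw [J.comm, J.unit_jmul]

theorem inner_jmul_left (J : EJA E) (a b c : E) :
    ⟪J.jmul a b, c⟫ = ⟪b, J.jmul a c⟫ := by
  rw [J.comm, J.assoc_inner]

/-- The linearized Jordan identity `[L_a, L_{b²}] + 2 [L_b, L_{a ∘ b}] = 0`. -/
theorem jordan_linearized (J : EJA E) (a b z : E) :
    J.jmul a (J.jmul (J.jmul b b) z) - J.jmul (J.jmul b b) (J.jmul a z)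
      + (2 : ℝ) • (J.jmul b (J.jmul (J.jmul a b) z) - J.jmul (J.jmul a b) (J.jmul b z)) = 0 := by
  have h1 := J.jordan (b + a) z
  have h2 := J.jordan (b - a) z
  have h3 := J.jordan a z
  simp only [map_add, map_sub, LinearMap.add_apply, LinearMap.sub_apply, J.comm b a] at h1 h2
  rw [← sub_eq_zero] at h1 h2 h3
  have h4 : (2 : ℝ) • (J.jmul a (J.jmul (J.jmul b b) z) - J.jmul (J.jmul b b) (J.jmul a z)
      + (2 : ℝ) • (J.jmul b (J.jmul (J.jmul a b) z)
        - J.jmul (J.jmul a b) (J.jmul b z))) = 0 := by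
    linear_combination (norm := module) h1 - h2 - (2 : ℝ) • h3
  exact (smul_eq_zero.mp h4).resolve_left two_ne_zero

/-- If `a ∘ b = 0`, then `L_a` commutes with `L_{b²}`. -/
theorem commute_sq_of_jmul_eq_zero (J : EJA E) {a b : E} (hab : J.jmul a b = 0) (z : E) :
    J.jmul a (J.jmul (J.jmul b b) z) = J.jmul (J.jmul b b) (J.jmul a z) := by
  have h := J.jordan_linearized a b z
  simpa [hab, sub_eq_zero] using h

/-- If `a` annihilates `b` and `c`, then `L_a` commutes with `L_{b ∘ c}`. -/
theorem commute_jmul_of_jmul_eq_zero (J : EJA E) {a b c : E} (hb : J.jmul a b = 0)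
    (hc : J.jmul a c = 0) (z : E) :
    J.jmul a (J.jmul (J.jmul b c) z) = J.jmul (J.jmul b c) (J.jmul a z) := by
  have h1 := J.commute_sq_of_jmul_eq_zero hb z
  have h2 := J.commute_sq_of_jmul_eq_zero hc z
  have h3 := J.commute_sq_of_jmul_eq_zero (a := a) (b := b + c) (by simp [hb, hc]) z
  simp only [map_add, LinearMap.add_apply, J.comm c b] at h3
  have h4 : (2 : ℝ) •
      (J.jmul a (J.jmul (J.jmul b c) z) - J.jmul (J.jmul b c) (J.jmul a z)) = 0 := by
    linear_combination (norm := module) h3 - h1 - h2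
  exact sub_eq_zero.mp ((smul_eq_zero.mp h4).resolve_left two_ne_zero)

/-- If an idempotent `p` annihilates `a`, then `L_a` and `L_p` commute. -/
theorem commute_idempotent (J : EJA E) {a p : E} (hp : J.jmul p p = p)
    (hap : J.jmul a p = 0) (z : E) :
    J.jmul a (J.jmul p z) = J.jmul p (J.jmul a z) := by
  have h := J.commute_sq_of_jmul_eq_zero hap z
  rwa [hp] at h

/-- The operator `L = L_p` of an idempotent satisfies `2 L³ - 3 L² + L = 0`. -/
theorem idempotent_cubic (J : EJA E) {p : E} (hp : J.jmul p p = p) (a : E) :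
    (2 : ℝ) • J.jmul p (J.jmul p (J.jmul p a)) - (3 : ℝ) • J.jmul p (J.jmul p a)
      + J.jmul p a = 0 := by
  have h := J.jordan_linearized a p p
  simp only [hp, J.comm a p, J.comm (J.jmul p a) p] at h
  linear_combination (norm := module) h

theorem idempotent_compl (J : EJA E) {p : E} (hp : J.jmul p p = p) :
    J.jmul (J.unit - p) (J.unit - p) = J.unit - p := by
  simp [J.unit_jmul, J.jmul_unit, hp]

theorem compl_jmul (J : EJA E) (p a : E) :
    J.jmul (J.unit - p) a = a - J.jmul p a := by
  simp [J.unit_jmul]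

/-- Elements of the Peirce spaces `E(p, 0)` and `E(p, 1)` annihilate each other. -/
theorem jmul_eq_zero_of_peirce (J : EJA E) {p a b : E} (hp : J.jmul p p = p)
    (ha : J.jmul p a = 0) (hb : J.jmul p b = b) : J.jmul a b = 0 := by
  have h1 := J.commute_idempotent hp (by rw [J.comm, ha] : J.jmul a p = 0) b
  have h2 := J.commute_idempotent (a := b) (J.idempotent_compl hp)
    (by rw [J.comm, J.compl_jmul, hb, sub_self]) a
  rw [J.compl_jmul, J.compl_jmul, ha, sub_zero, J.comm b a, ← h1, hb, sub_self] at h2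
  exact h2

/-- With `L = L_p`, the quadratic form of `L - L²` is `4 ‖(L - L²) a‖²`. -/
theorem inner_idempotent (J : EJA E) {p : E} (hp : J.jmul p p = p) (a : E) :
    ⟪J.jmul p a, a⟫ - ⟪J.jmul p a, J.jmul p a⟫ =
      4 * ⟪J.jmul p a - J.jmul p (J.jmul p a), J.jmul p a - J.jmul p (J.jmul p a)⟫ := by
  have h3 := congrArg (fun u => ⟪u, a⟫) (J.idempotent_cubic hp a)
  have h4 := congrArg (fun u => ⟪u, J.jmul p a⟫) (J.idempotent_cubic hp a)
  simp only [inner_add_left, inner_sub_left, inner_smul_left, inner_zero_left,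
    RCLike.conj_to_real] at h3 h4
  rw [J.inner_jmul_left p (J.jmul p (J.jmul p a)) a,
    J.inner_jmul_left p (J.jmul p a) a] at h3
  rw [J.inner_jmul_left p (J.jmul p (J.jmul p a)) (J.jmul p a)] at h4
  simp only [inner_sub_left, inner_sub_right]
  rw [real_inner_comm (J.jmul p (J.jmul p a)) (J.jmul p a)]
  linarith

theorem inner_idempotent_nonneg (J : EJA E) {p : E} (hp : J.jmul p p = p) (a : E) :
    0 ≤ ⟪J.jmul p a, a⟫ := by
  have h := J.inner_idempotent hp a
  have h1 := real_inner_self_nonneg (x := J.jmul p a)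
  have h2 := real_inner_self_nonneg (x := J.jmul p a - J.jmul p (J.jmul p a))
  linarith

theorem jmul_eq_zero_of_inner_idempotent (J : EJA E) {p a : E} (hp : J.jmul p p = p)
    (ha : ⟪J.jmul p a, a⟫ = 0) : J.jmul p a = 0 := by
  have h := J.inner_idempotent hp a
  have h1 := real_inner_self_nonneg (x := J.jmul p a)
  have h2 := real_inner_self_nonneg (x := J.jmul p a - J.jmul p (J.jmul p a))
  exact inner_self_eq_zero.mp (by linarith : ⟪J.jmul p a, J.jmul p a⟫ = (0 : ℝ))

theorem inner_unit_of_idempotent (J : EJA E) {p : E} (hp : J.jmul p p = p) :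
    ⟪p, J.unit⟫ = ⟪p, p⟫ := by
  conv_lhs => rw [← hp, J.assoc_inner, J.jmul_unit]

theorem isJordanFrame_inner_unit (J : EJA E) {c : Fin J.rank → E} (hc : J.IsJordanFrame c)
    (i : Fin J.rank) : ⟪c i, J.unit⟫ = (1 : ℝ) := by
  obtain ⟨hi, hn, hprim⟩ := hc.1 i
  rw [J.inner_unit_of_idempotent hi]
  exact J.inner_primitive _ hi hn hprim

theorem exists_spectral (J : EJA E) (a : E) :
    ∃ (c : Fin J.rank → E) (σ : Fin J.rank → ℝ),
      J.IsJordanFrame c ∧ a = ∑ i, σ i • c i := by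
  obtain ⟨c, σ, h1, h2, h3, h4, h5, h6⟩ := J.spectral a
  exact ⟨c, σ, ⟨fun i => ⟨h1 i, h2 i, h3 i⟩, h4, h5⟩, h6⟩

theorem inner_unit_unit (J : EJA E) : ⟪J.unit, J.unit⟫ = (J.rank : ℝ) := by
  obtain ⟨c, σ, hc, -⟩ := J.exists_spectral 0
  conv_lhs => rw [← hc.2.2, sum_inner]
  simp [hc.2.2, J.isJordanFrame_inner_unit hc]

theorem jmul_sum_frame (J : EJA E) {c : Fin J.rank → E} (hc : J.IsJordanFrame c)
    (σ τ : Fin J.rank → ℝ) :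
    J.jmul (∑ i, σ i • c i) (∑ i, τ i • c i) = ∑ i, (σ i * τ i) • c i := by
  simp only [map_sum, LinearMap.sum_apply, map_smul, LinearMap.smul_apply]
  refine Finset.sum_congr rfl fun i _ => ?_
  rw [Finset.sum_eq_single i]
  · have h : J.jmul (c i) (c i) = c i := (hc.1 i).1
    rw [h, smul_smul, mul_comm]
  · intro j _ hj
    rw [hc.2.1 j i hj, smul_zero]
  · simp

/-- `p` is the idempotent projecting onto the kernel of `a`. -/
structure IsKernelIdempotent (J : EJA E) (a p : E) : Prop where
  idem : J.jmul p p = p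
  jmul_eq_zero : J.jmul a p = 0
  exists_compl : ∃ z, J.jmul a z = J.unit - p

theorem HasRank.exists_isKernelIdempotent {J : EJA E} {a : E} {k : ℕ} (ha : J.HasRank a k) :
    ∃ p, J.IsKernelIdempotent a p ∧ (k : ℝ) + ⟪p, J.unit⟫ = J.rank := by
  obtain ⟨c, σ, hc, rfl, rfl⟩ := ha
  have hunit : J.unit = ∑ i, (1 : ℝ) • c i := by simp [hc.2.2]
  refine ⟨∑ i, (if σ i = 0 then (1 : ℝ) else 0) • c i, ⟨?_, ?_, ∑ i, (σ i)⁻¹ • c i, ?_⟩, ?_⟩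
  · rw [J.jmul_sum_frame hc]
    simp [← ite_and]
  · rw [J.jmul_sum_frame hc]
    exact Finset.sum_eq_zero fun i _ => by by_cases h : σ i = 0 <;> simp [h]
  · rw [J.jmul_sum_frame hc, hunit, ← Finset.sum_sub_distrib]
    refine Finset.sum_congr rfl fun i _ => ?_
    rw [← sub_smul]
    by_cases h : σ i = 0 <;> simp [h]
  · rw [sum_inner]
    simp only [inner_smul_left, J.isJordanFrame_inner_unit hc, RCLike.conj_to_real, mul_one]
    rw [Finset.card_filter, Nat.cast_sum, ← Finset.sum_add_distrib,
      Finset.sum_congr rfl (g := fun _ => (1 : ℝ))]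
    · simp
    · intro i _
      by_cases h : σ i = 0 <;> simp [h]

theorem exists_isKernelIdempotent (J : EJA E) (a : E) : ∃ p, J.IsKernelIdempotent a p := by
  obtain ⟨c, σ, hc, h⟩ := J.exists_spectral a
  obtain ⟨p, hp, -⟩ := HasRank.exists_isKernelIdempotent (J := J) ⟨c, σ, hc, h, rfl⟩
  exact ⟨p, hp⟩

theorem IsKernelIdempotent.inner_eq {J : EJA E} {a p b : E} (hp : J.IsKernelIdempotent a p)
    (hb : J.jmul a b = 0) : ⟪p, b⟫ = ⟪J.unit, b⟫ := by
  obtain ⟨z, hz⟩ := hp.exists_compl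
  have h : ⟪J.unit - p, b⟫ = (0 : ℝ) := by
    rw [← hz, J.inner_jmul_left, hb, inner_zero_right]
  rw [inner_sub_left] at h
  linarith

/-- The kernel idempotents of `y` and `y ∘ y` have the same trace. -/
theorem inner_unit_kernel_sq (J : EJA E) {y p q : E} (hp : J.IsKernelIdempotent y p)
    (hq : J.IsKernelIdempotent (J.jmul y y) q) : ⟪q, J.unit⟫ = ⟪p, J.unit⟫ := by
  have h1 : J.jmul (J.jmul y y) p = 0 := by
    have h := J.commute_idempotent hp.idem hp.jmul_eq_zero y
    rw [J.comm p y, hp.jmul_eq_zero, map_zero] at h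
    rw [J.comm, ← h]
  have h2 : J.jmul y q = 0 := by
    rw [J.comm]
    apply J.jmul_eq_zero_of_inner_idempotent hq.idem
    rw [J.assoc_inner, ← hq.idem, J.assoc_inner, J.comm q, hq.jmul_eq_zero, inner_zero_right]
  rw [real_inner_comm, ← hp.inner_eq h2, real_inner_comm, hq.inner_eq h1, real_inner_comm]

section SecondOrder

variable {J : EJA E} {y lam p : E}

/-- If `y ∘ λ = 0` and `⟪w ∘ w, λ⟫ > 0` for all nonzero `w` annihilated by `y`, then `λ` lies in
the Peirce space `E(p, 1)` of the kernel idempotent `p` of `y`. -/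
theorem IsKernelIdempotent.jmul_eq_self (hp : J.IsKernelIdempotent y p) (hlam : J.jmul y lam = 0)
    (hpos : ∀ w, w ≠ 0 → J.jmul y w = 0 → 0 < ⟪J.jmul w w, lam⟫) : J.jmul p lam = lam := by
  have triple : ∀ a b c, J.jmul y a = 0 → J.jmul y b = 0 → J.jmul y c = 0 →
      ⟪p, J.jmul (J.jmul a b) c⟫ = ⟪J.unit, J.jmul (J.jmul a b) c⟫ := by
    intro a b c ha hb hc
    apply hp.inner_eq
    rw [J.commute_jmul_of_jmul_eq_zero ha hb, hc, map_zero]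
  have hplam : J.jmul y (J.jmul p lam) = 0 := by
    rw [J.commute_idempotent hp.idem hp.jmul_eq_zero, hlam, map_zero]
  have hidem : J.jmul p (J.jmul p lam) = J.jmul p lam := by
    have h := J.inner_idempotent hp.idem lam
    have ht := triple p lam lam hp.jmul_eq_zero hlam hlam
    rw [J.comm (J.jmul p lam) lam, ← J.inner_jmul_left lam p, ← J.inner_jmul_left lam J.unit,
      J.jmul_unit, J.comm lam p] at ht
    have h0 : ⟪J.jmul p lam - J.jmul p (J.jmul p lam),
        J.jmul p lam - J.jmul p (J.jmul p lam)⟫ = (0 : ℝ) := by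
      rw [real_inner_comm lam] at h
      linarith
    exact (sub_eq_zero.mp (inner_self_eq_zero.mp h0)).symm
  by_contra hne
  set w := lam - J.jmul p lam with hw
  have hw0 : w ≠ 0 := fun h => hne (sub_eq_zero.mp h).symm
  have hyw : J.jmul y w = 0 := by rw [hw, map_sub, hlam, hplam, sub_zero]
  have hpw : J.jmul p w = 0 := by rw [hw, map_sub, hidem, sub_self]
  have hpw2 : J.jmul p (J.jmul w w) = 0 := by
    rw [← J.commute_idempotent hp.idem (by rw [J.comm, hpw]), hpw, map_zero]
  have ht := triple w w lam hyw hyw hlam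
  rw [← J.inner_jmul_left, ← J.inner_jmul_left, J.jmul_unit, J.comm _ p, hpw2,
    inner_zero_left] at ht
  exact (hpos w hw0 hyw).ne ht

/-- Under the same condition, `λ` belongs to the symmetric cone. -/
theorem IsKernelIdempotent.mem_K (hp : J.IsKernelIdempotent y p) (hlam : J.jmul p lam = lam)
    (hpos : ∀ w, w ≠ 0 → J.jmul y w = 0 → 0 < ⟪J.jmul w w, lam⟫) : lam ∈ J.K := by
  obtain ⟨d, τ, hd, hsum⟩ := J.exists_spectral lam
  have hid : ∀ j, J.jmul (d j) (d j) = d j := fun j => (hd.1 j).1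
  have hcompl := J.idempotent_compl hp.idem
  have hterm : ∀ j, 0 ≤ ⟪J.jmul (J.unit - p) (d j), d j⟫ :=
    fun j => J.inner_idempotent_nonneg hcompl (d j)
  have htrace : ∑ j, (τ j * τ j) * ⟪J.jmul (J.unit - p) (d j), d j⟫ = 0 := by
    have h : ⟪J.jmul lam lam, J.unit - p⟫ = (0 : ℝ) := by
      rw [J.assoc_inner, J.comm lam, J.compl_jmul, hlam, sub_self, inner_zero_right]
    rw [hsum, J.jmul_sum_frame hd, sum_inner] at h
    rw [← h]
    refine Finset.sum_congr rfl fun j _ => ?_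
    rw [inner_smul_left, J.assoc_inner, hid j, real_inner_comm]
    simp
  have hzero := (Finset.sum_eq_zero_iff_of_nonneg
    (fun j _ => mul_nonneg (mul_self_nonneg (τ j)) (hterm j))).mp htrace
  have hnonneg : ∀ j, 0 ≤ τ j := by
    intro j
    by_contra hneg
    have hτ : τ j ≠ 0 := fun h => hneg h.ge
    have h1 : J.jmul (J.unit - p) (d j) = 0 :=
      J.jmul_eq_zero_of_inner_idempotent hcompl
        ((mul_eq_zero.mp (hzero j (Finset.mem_univ j))).resolve_left (mul_self_ne_zero.mpr hτ))
    rw [J.compl_jmul, sub_eq_zero] at h1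
    have h2 : J.jmul y (d j) = 0 :=
      J.jmul_eq_zero_of_peirce hp.idem (by rw [J.comm, hp.jmul_eq_zero]) h1.symm
    have h3 := hpos (d j) (hd.1 j).2.1 h2
    have h4 : J.jmul (d j) lam = τ j • d j := by
      have h := J.jmul_sum_frame hd (Pi.single j 1) τ
      rw [← hsum] at h
      simpa [Pi.single_apply, ite_smul] using h
    rw [J.assoc_inner, h4, inner_smul_right] at h3
    have h5 := real_inner_self_nonneg (x := d j)
    exact hneg (pos_of_mul_pos_left h3 h5).le
  refine ⟨∑ j, √(τ j) • d j, ?_⟩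
  rw [J.jmul_sum_frame hd, hsum]
  simp [Real.mul_self_sqrt (hnonneg _)]

/-- Under the same condition, the kernel idempotents of `y` and `λ` have complementary traces. -/
theorem IsKernelIdempotent.inner_unit_add {q : E} (hp : J.IsKernelIdempotent y p)
    (hlam : J.jmul p lam = lam) (hq : J.IsKernelIdempotent lam q)
    (hpos : ∀ w, w ≠ 0 → J.jmul y w = 0 → 0 < ⟪J.jmul w w, lam⟫) :
    ⟪p, J.unit⟫ + ⟪q, J.unit⟫ = (J.rank : ℝ) := by
  have hcompl : J.jmul lam (J.unit - p) = 0 := by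
    rw [J.comm, J.compl_jmul, hlam, sub_self]
  have hcomm : ∀ z, J.jmul lam (J.jmul p z) = J.jmul p (J.jmul lam z) := by
    intro z
    have h := J.commute_idempotent (J.idempotent_compl hp.idem) hcompl z
    rwa [J.compl_jmul, J.compl_jmul, map_sub, sub_right_inj] at h
  set w := (2 : ℝ) • J.jmul p (J.jmul p q) - J.jmul p q with hw
  have hlw : J.jmul lam w = 0 := by
    simp [hw, hcomm, hq.jmul_eq_zero]
  have hpw : J.jmul p w = w := by
    have h := J.idempotent_cubic hp.idem q
    simp only [hw, map_sub, map_smul]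
    linear_combination (norm := module) h
  have hyw : J.jmul y w = 0 :=
    J.jmul_eq_zero_of_peirce hp.idem (by rw [J.comm, hp.jmul_eq_zero]) hpw
  have hw0 : w = 0 := by
    by_contra hne
    have h := hpos w hne hyw
    rw [J.assoc_inner, J.comm w, hlw, inner_zero_right] at h
    exact h.false
  have hpq : ⟪p, q⟫ = (0 : ℝ) := by
    have h : ⟪w, J.unit⟫ = (0 : ℝ) := by rw [hw0, inner_zero_left]
    rw [hw, inner_sub_left, inner_smul_left, J.inner_jmul_left, J.inner_jmul_left,
      J.inner_jmul_left, J.jmul_unit, hp.idem, real_inner_comm] at h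
    simp only [RCLike.conj_to_real] at h
    linarith
  have h1 := hq.inner_eq hcompl
  have h2 := J.inner_unit_unit
  rw [inner_sub_right, inner_sub_right, real_inner_comm p q, hpq,
    real_inner_comm p J.unit] at h1
  linarith

end SecondOrder

end EJA

/-- a KKT quadruple of (P2) at which the SOSC-NLP holds yields
a KKT triple of (P1) satisfying strict complementarity. -/
theorem stmt10 {E : Type*} [NormedAddCommGroup E] [InnerProductSpace ℝ E]
    [FiniteDimensional ℝ E] (J : EJA E) {n m : ℕ}
    (f : EuclideanSpace ℝ (Fin n) → ℝ)
    (h : EuclideanSpace ℝ (Fin n) → EuclideanSpace ℝ (Fin m))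
    (g : EuclideanSpace ℝ (Fin n) → E)
    (hf : ContDiff ℝ 2 f) (hh : ContDiff ℝ 2 h) (hg : ContDiff ℝ 2 g)
    (x : EuclideanSpace ℝ (Fin n)) (y : E)
    (μ : EuclideanSpace ℝ (Fin m)) (lam : E)
    (hKKT : J.KKTP2 f h g x y μ lam)
    (hsosc : ∀ (v : EuclideanSpace ℝ (Fin n)) (w : E), (v, w) ≠ (0, 0) →
      fderiv ℝ g x v - (2 : ℝ) • J.jmul y w = 0 → fderiv ℝ h x v = 0 →
      0 < iteratedFDeriv ℝ 2 (EJA.lagr f h g μ lam) x ![v, v]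
          + 2 * ⟪J.jmul w w, lam⟫) :
    J.KKTP1 f h g x μ lam ∧
      ∀ kg kl : ℕ, J.HasRank (g x) kg → J.HasRank lam kl →
        kg + kl = J.rank := by
  obtain ⟨hgrad, hly, hgx, hhx⟩ := hKKT
  have hpos : ∀ w, w ≠ 0 → J.jmul y w = 0 → 0 < ⟪J.jmul w w, lam⟫ := by
    intro w hw hyw
    have hs := hsosc 0 w (by simpa using hw) (by simp [hyw]) (by simp)
    rw [ContinuousMultilinearMap.map_coord_zero _ (0 : Fin 2) rfl] at hs
    linarith
  obtain ⟨p, hp⟩ := J.exists_isKernelIdempotent y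
  have hplam := hp.jmul_eq_self (by rw [J.comm, hly]) hpos
  refine ⟨⟨hgrad, hp.mem_K hplam hpos, ⟨y, hgx⟩, ?_, hhx⟩, fun kg kl hkg hkl => ?_⟩
  · have hpy : J.jmul p (J.jmul y y) = 0 := by
      rw [← J.commute_idempotent hp.idem hp.jmul_eq_zero, J.comm p y, hp.jmul_eq_zero, map_zero]
    rw [J.comm, hgx]
    exact J.jmul_eq_zero_of_peirce hp.idem hpy hplam
  · rw [hgx] at hkg
    obtain ⟨pg, hpg, htg⟩ := hkg.exists_isKernelIdempotent
    obtain ⟨pl, hpl, htl⟩ := hkl.exists_isKernelIdempotent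
    have h1 := J.inner_unit_kernel_sq hp hpg
    have h2 := hp.inner_unit_add hplam hpl hpos
    have h3 : (kg : ℝ) + kl = J.rank := by linarith
    exact_mod_cast h3
end
end

section
/- Consider problem (P1) and a point x ∈ ℝⁿ with g(x) ∈ K. Say x is nondegenerate if for all v ∈ ℝᵐ and w ∈ E, w ∈ (lin T_K(g(x)))^⊥ and Dg(x)*w + Dh(x)*v = 0 imply w = 0 and v = 0; say (x, y) satisfies LICQ for problem (P2) if for all v ∈ ℝᵐ and w ∈ E, y∘w = 0 and Dg(x)*w + Dh(x)*v = 0 imply w = 0 and v = 0. Then: (1) if y ∈ K, g(x) = y∘y, and (x, y) satisfies LICQ for (P2), then x is nondegenerate; (2) conversely, if x is nondegenerate and y = √(g(x)), then (x, y) satisfies LICQ for (P2). -/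
open scoped RealInnerProductSpace

noncomputable section

namespace EJA

variable {E : Type*} [NormedAddCommGroup E] [InnerProductSpace ℝ E]
  [FiniteDimensional ℝ E] (J : EJA E)

lemma inner_jmul_left_s13 (y z w : E) : ⟪J.jmul y z, w⟫ = ⟪z, J.jmul y w⟫ := by
  rw [J.comm, J.assoc_inner]

/-- The Peirce polynomial `2 L³ - 3 L² + L` annihilates multiplication by an idempotent. -/
lemma peirce {c : E} (hc : J.jmul c c = c) (b : E) :
    (2 : ℝ) • J.jmul c (J.jmul c (J.jmul c b)) + J.jmul c b
      = (3 : ℝ) • J.jmul c (J.jmul c b) := by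
  have h1 := J.jordan (c + b) c
  have h2 := J.jordan (c - b) c
  have h3 := J.jordan b c
  simp only [map_add, map_sub, LinearMap.add_apply, LinearMap.sub_apply, hc, J.comm b c,
    J.comm (J.jmul c b) c, J.comm b (J.jmul c _),
    J.comm (J.jmul b b) c] at h1 h2 h3
  linear_combination (norm := module) (1 / 2 : ℝ) • h1 - (1 / 2 : ℝ) • h2 - h3

/-- Multiplication by an idempotent is positive semidefinite. -/
lemma inner_idempotent_sq_nonneg {c : E} (hc : J.jmul c c = c) (a : E) :
    0 ≤ ⟪c, J.jmul a a⟫ := by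
  set p := J.jmul c a with hp
  set q := J.jmul c p with hq
  set r := J.jmul c q with hr
  have hpe : (2 : ℝ) • r + p = (3 : ℝ) • q := J.peirce hc a
  have hpp : ⟪a, q⟫ = ⟪p, p⟫ := by rw [hq, ← inner_jmul_left_s13]
  have hqp : ⟪a, r⟫ = ⟪p, q⟫ := by rw [hr, ← inner_jmul_left_s13]
  have hrp : ⟪p, r⟫ = ⟪q, q⟫ := by rw [hr, ← inner_jmul_left_s13]
  have e1 := congrArg (fun u => ⟪a, u⟫) hpe
  have e2 := congrArg (fun u => ⟪p, u⟫) hpe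
  simp only [inner_add_right, inner_smul_right] at e1 e2
  have e3 : ⟪c, J.jmul a a⟫ = ⟪a, p⟫ := by
    rw [← J.assoc_inner, real_inner_comm]
  have e4 : ⟪p - q, p - q⟫ = ⟪p, p⟫ - 2 * ⟪p, q⟫ + ⟪q, q⟫ := by
    simp only [inner_sub_left, inner_sub_right, real_inner_comm p q]
    ring
  have n1 : 0 ≤ ⟪p, p⟫ := real_inner_self_nonneg
  have n2 : 0 ≤ ⟪p - q, p - q⟫ := real_inner_self_nonneg
  linarith

lemma jmul_frame_sum {ι : Type*} [Fintype ι] {c : ι → E}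
    (hi : ∀ i, J.jmul (c i) (c i) = c i) (ho : ∀ i j, i ≠ j → J.jmul (c i) (c j) = 0)
    (σ : ι → ℝ) :
    J.jmul (∑ i, σ i • c i) (∑ i, σ i • c i) = ∑ i, (σ i * σ i) • c i := by
  classical
  simp only [map_sum, LinearMap.sum_apply, map_smul, LinearMap.smul_apply]
  refine Finset.sum_congr rfl fun i _ => ?_
  rw [Finset.sum_eq_single i]
  · rw [hi, smul_smul]
  · intro j _ hj
    rw [ho _ _ hj]; simp
  · simp

/-- An idempotent orthogonal to `y ∈ K` is orthogonal to `y∘y`. -/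
lemma inner_sq_eq_zero {c y : E} (hc : J.jmul c c = c) (hy : y ∈ J.K) (h : ⟪c, y⟫ = 0) :
    ⟪c, J.jmul y y⟫ = 0 := by
  obtain ⟨k, hk⟩ := hy
  obtain ⟨d, τ, hi, h0, -, ho, -, hd⟩ := J.spectral y
  have hτ : ∀ j, 0 ≤ τ j := by
    intro j
    have h1 : ⟪d j, y⟫ = τ j * ⟪d j, d j⟫ := by
      rw [hd, inner_sum, Finset.sum_eq_single j]
      · rw [inner_smul_right]
      · intro i _ hij
        rw [inner_smul_right, ← hi j, J.assoc_inner, ho j i hij.symm]; simp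
      · simp
    have h2 : 0 ≤ ⟪d j, y⟫ := hk ▸ J.inner_idempotent_sq_nonneg (hi j) k
    exact nonneg_of_mul_nonneg_left (h1 ▸ h2) (real_inner_self_pos.2 (h0 j))
  have hnn : ∀ j ∈ Finset.univ, 0 ≤ τ j * ⟪c, d j⟫ := fun j _ =>
    mul_nonneg (hτ j) (hi j ▸ J.inner_idempotent_sq_nonneg hc (d j))
  rw [hd, inner_sum] at h
  simp only [inner_smul_right] at h
  rw [Finset.sum_eq_zero_iff_of_nonneg hnn] at h
  rw [hd, J.jmul_frame_sum hi ho, inner_sum]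
  refine Finset.sum_eq_zero fun j hj => ?_
  rw [inner_smul_right, mul_assoc, h j hj, mul_zero]

/-- The range of multiplication by `y` consists of tangent directions at `y∘y`. -/
lemma jmul_mem_tangentCone (y a : E) : J.jmul y a ∈ J.tangentCone (J.jmul y y) := by
  have hlim : Filter.Tendsto (fun t : ℝ => J.jmul y a + (t / 2) • J.jmul a a)
      (nhdsWithin 0 (Set.Ioi 0)) (nhds (J.jmul y a)) := by
    have : Continuous fun t : ℝ => J.jmul y a + (t / 2) • J.jmul a a := by fun_prop
    simpa using (this.tendsto 0).mono_left nhdsWithin_le_nhds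
  refine mem_closure_of_tendsto hlim ?_
  filter_upwards [self_mem_nhdsWithin] with t ht
  have ht0 : (0 : ℝ) < t := ht
  refine ⟨1 / (2 * t), by positivity, _, ⟨y + t • a, rfl⟩, ?_⟩
  simp only [map_add, map_smul, LinearMap.add_apply, LinearMap.smul_apply, J.comm a y]
  match_scalars <;> field_simp
  all_goals norm_num

/-- An idempotent orthogonal to `z` is nonnegative on the tangent cone of `K` at `z`. -/
lemma inner_nonneg_of_mem_tangentCone {c z d : E} (hc : J.jmul c c = c) (hz : ⟪c, z⟫ = 0)
    (hd : d ∈ J.tangentCone z) : 0 ≤ ⟪c, d⟫ := by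
  have hcl : IsClosed {d : E | 0 ≤ ⟪c, d⟫} := isClosed_le (by fun_prop) (by fun_prop)
  refine closure_minimal ?_ hcl hd
  rintro _ ⟨t, ht, _, ⟨k, rfl⟩, rfl⟩
  simp only [Set.mem_ofPred_eq, inner_smul_right, inner_sub_right, hz, sub_zero]
  exact mul_nonneg ht.le (J.inner_idempotent_sq_nonneg hc k)

/-- For `y ∈ K`, the orthogonal complement of the lineality space of the tangent cone
at `y∘y` is the kernel of multiplication by `y`. -/
lemma orthogonal_linTangent_iff {y : E} (hy : y ∈ J.K) (w : E) :
    (∀ u ∈ J.linTangent (J.jmul y y), ⟪w, u⟫ = 0) ↔ J.jmul y w = 0 := by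
  constructor
  · intro h
    have h1 := h (J.jmul y (J.jmul y w)) ⟨J.jmul_mem_tangentCone y _, by
      rw [← map_neg]; exact J.jmul_mem_tangentCone y _⟩
    rwa [← inner_jmul_left_s13, inner_self_eq_zero] at h1
  · rintro h u ⟨hu, hnu⟩
    obtain ⟨c, σ, hi, -, -, ho, -, hw⟩ := J.spectral w
    have hyc : ∀ i, 0 ≤ ⟪c i, y⟫ := by
      obtain ⟨k, rfl⟩ := hy
      exact fun i => J.inner_idempotent_sq_nonneg (hi i) k
    have hyw : ⟪J.jmul w w, y⟫ = 0 := by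
      rw [J.assoc_inner, J.comm w y, h, inner_zero_right]
    rw [hw, J.jmul_frame_sum hi ho, sum_inner] at hyw
    simp only [real_inner_smul_left] at hyw
    rw [Finset.sum_eq_zero_iff_of_nonneg
      (fun i _ => mul_nonneg (mul_self_nonneg _) (hyc i))] at hyw
    rw [hw, sum_inner]
    refine Finset.sum_eq_zero fun i hmem => ?_
    rw [real_inner_smul_left]
    rcases mul_eq_zero.1 (hyw i hmem) with h1 | h1
    · rw [mul_self_eq_zero.1 h1, zero_mul]
    · have hz := J.inner_sq_eq_zero (hi i) hy h1
      have p1 := J.inner_nonneg_of_mem_tangentCone (hi i) hz hu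
      have p2 := J.inner_nonneg_of_mem_tangentCone (hi i) hz hnu
      rw [inner_neg_right] at p2
      rw [le_antisymm (by linarith) p1, mul_zero]

end EJA

/-- comparison of nondegeneracy for (P1) and LICQ for (P2):
LICQ at `(x, y)` with `y ∈ K`, `g(x) = y∘y` implies nondegeneracy at `x`;
conversely nondegeneracy at `x` implies LICQ at `(x, √(g(x)))`. -/
theorem stmt13 {E : Type*} [NormedAddCommGroup E] [InnerProductSpace ℝ E]
    [FiniteDimensional ℝ E] (J : EJA E) {n m : ℕ}
    (h : EuclideanSpace ℝ (Fin n) → EuclideanSpace ℝ (Fin m))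
    (g : EuclideanSpace ℝ (Fin n) → E)
    (hh : ContDiff ℝ 2 h) (hg : ContDiff ℝ 2 g)
    (x : EuclideanSpace ℝ (Fin n)) (hx : g x ∈ J.K) :
    (∀ y : E, y ∈ J.K → g x = J.jmul y y →
      (∀ (v : EuclideanSpace ℝ (Fin m)) (w : E), J.jmul y w = 0 →
        (fderiv ℝ g x).adjoint w + (fderiv ℝ h x).adjoint v = 0 →
        w = 0 ∧ v = 0) →
      ∀ (v : EuclideanSpace ℝ (Fin m)) (w : E),
        (∀ u ∈ J.linTangent (g x), ⟪w, u⟫ = 0) →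
        (fderiv ℝ g x).adjoint w + (fderiv ℝ h x).adjoint v = 0 →
        w = 0 ∧ v = 0) ∧
    (∀ y : E, y ∈ J.K → J.jmul y y = g x →
      (∀ (v : EuclideanSpace ℝ (Fin m)) (w : E),
        (∀ u ∈ J.linTangent (g x), ⟪w, u⟫ = 0) →
        (fderiv ℝ g x).adjoint w + (fderiv ℝ h x).adjoint v = 0 →
        w = 0 ∧ v = 0) →
      ∀ (v : EuclideanSpace ℝ (Fin m)) (w : E), J.jmul y w = 0 →
        (fderiv ℝ g x).adjoint w + (fderiv ℝ h x).adjoint v = 0 →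
        w = 0 ∧ v = 0) := by
  constructor
  · intro y hy hgy hL v w hw
    rw [hgy] at hw
    exact hL v w ((J.orthogonal_linTangent_iff hy w).1 hw)
  · intro y hy hgy hN v w hw
    rw [← hgy] at hN
    exact hN v w ((J.orthogonal_linTangent_iff hy w).2 hw)
end
end
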